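/- For every 𝔷-module N on which z acts invertibly, the map N → (U(𝔥) ⊗_{U(𝔭)} E(N))^𝔩 sending n to 1 ⊗ n is an isomorphism of 𝔷-modules; that is, the 𝔩-invariants of G(N) are naturally isomorphic to N. -/

import Mathlib

open scoped TensorProduct

structure AltBilin (k V : Type*) [Field k] [AddCommGroup V] [Module k V] where
  form : V →ₗ[k] V →ₗ[k] k
  alt : ∀ v : V, form v v = 0

variable {k V : Type*} [Field k] [AddCommGroup V] [Module k V]

def Heisenberg (ω : AltBilin k V) : Type _ := V × k

namespace Heisenberg
variable (ω : AltBilin k V)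
instance : AddCommGroup (Heisenberg ω) := inferInstanceAs (AddCommGroup (V × k))
instance : Module k (Heisenberg ω) := inferInstanceAs (Module k (V × k))
instance : LieRing (Heisenberg ω) where
  bracket x y := (((0 : V), ω.form x.1 y.1) : V × k)
  add_lie x y z := by
    show (((0 : V), ω.form (x.1 + y.1) z.1) : V × k)
      = ((0 : V), ω.form x.1 z.1) + ((0 : V), ω.form y.1 z.1)
    ext <;> simp
  lie_add x y z := by
    show (((0 : V), ω.form x.1 (y.1 + z.1)) : V × k)
      = ((0 : V), ω.form x.1 y.1) + ((0 : V), ω.form x.1 z.1)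
    ext <;> simp
  lie_self x := by
    show (((0 : V), ω.form x.1 x.1) : V × k) = 0
    ext <;> simp [ω.alt]
  leibniz_lie x y z := by
    show (((0 : V), ω.form x.1 ((0 : V), ω.form y.1 z.1).1) : V × k)
      = (((0 : V), ω.form ((0 : V), ω.form x.1 y.1).1 z.1) : V × k)
        + (((0 : V), ω.form y.1 ((0 : V), ω.form x.1 z.1).1) : V × k)
    ext <;> simp
instance : LieAlgebra k (Heisenberg ω) where
  lie_smul t x y := by
    show (((0 : V), ω.form x.1 (t • y).1) : V × k)
      = t • (((0 : V), ω.form x.1 y.1) : V × k)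
    have h1 : (t • y).1 = t • y.1 := rfl
    ext <;> simp [h1]
def zH : Heisenberg ω := (((0 : V), (1 : k)) : V × k)
def ofV (v : V) : Heisenberg ω := ((v, (0 : k)) : V × k)
def ofVk (v : V) (c : k) : Heisenberg ω := ((v, c) : V × k)
end Heisenberg


section Defs

variable (ω : AltBilin k V)
variable (N : Type*) [AddCommGroup N] [Module k N]

/-- The submodule of relations presenting `G(N) = U(𝔥) ⊗_{U(𝔭)} E(N)` as a
quotient of `U(𝔥) ⊗_k N`: it is spanned by the elements
`(u·ι(x,c)) ⊗ n − u ⊗ (c • ζ n)` for `x ∈ 𝔩`, `c ∈ k`, `n ∈ N`, where `ζ` is the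
action of the central element `z` on the `𝔷`-module `N` and `𝔩` acts on `E(N)`
by zero. -/
noncomputable def relN (l : Submodule k V) (ζ : Module.End k N) :
    Submodule k (UniversalEnvelopingAlgebra k (Heisenberg ω) ⊗[k] N) :=
  Submodule.span k
    {t | ∃ (u : UniversalEnvelopingAlgebra k (Heisenberg ω)) (x : V),
        x ∈ l ∧ ∃ (c : k) (n : N),
          t = (u * UniversalEnvelopingAlgebra.ι k (Heisenberg.ofVk ω x c)) ⊗ₜ[k] n
              - u ⊗ₜ[k] (c • ζ n)}

/-- Left multiplication by `ι(h)` on the first factor of `U(𝔥) ⊗_k N`; this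
induces the `𝔥`-module structure on `G(N)`. -/
noncomputable def lmul (h : Heisenberg ω) :
    (UniversalEnvelopingAlgebra k (Heisenberg ω) ⊗[k] N) →ₗ[k]
      (UniversalEnvelopingAlgebra k (Heisenberg ω) ⊗[k] N) :=
  TensorProduct.map (LinearMap.mulLeft k (UniversalEnvelopingAlgebra.ι k h)) LinearMap.id

end Defs

namespace AltBilin

variable (ω : AltBilin k V)

theorem neg_form (v w : V) : -ω.form v w = ω.form w v := by
  have h := ω.alt (v + w)
  simp only [map_add, LinearMap.add_apply, ω.alt, zero_add, add_zero] at h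
  exact neg_eq_of_add_eq_zero_left h

theorem form_eq_zero_of_lagrangian {l : Submodule k V}
    (hLag : ∀ v : V, v ∈ l ↔ ∀ x ∈ l, ω.form v x = 0) {v w : V} (hv : v ∈ l) (hw : w ∈ l) :
    ω.form v w = 0 :=
  (hLag v).1 hv w hw

/-- A basis of a Lagrangian subspace extends to a Darboux basis: there is a dual isotropic
family. -/
theorem exists_isotropic_dual [CharZero k] [FiniteDimensional k V]
    (hnondeg : ∀ v : V, (∀ w : V, ω.form v w = 0) → v = 0) {l : Submodule k V}
    (hLag : ∀ v : V, v ∈ l ↔ ∀ x ∈ l, ω.form v x = 0) {ι : Type*} [Fintype ι] [DecidableEq ι]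
    (b : Module.Basis ι k l) :
    ∃ y : ι → V, (∀ i j, ω.form (b i) (y j) = if i = j then 1 else 0) ∧
      ∀ i j, ω.form (y i) (y j) = 0 := by
  have hinj : Function.Injective ω.form := by
    rw [← LinearMap.ker_eq_bot, LinearMap.ker_eq_bot']
    intro v hv
    exact hnondeg v fun w => by rw [hv, LinearMap.zero_apply]
  have hsurj : Function.Surjective ω.form :=
    (LinearMap.injective_iff_surjective_of_finrank_eq_finrank
      (Subspace.dual_finrank_eq (K := k) (V := V)).symm).1 hinj
  have hdual : ∀ j, ∃ y : V, ∀ i, ω.form (b i) y = if i = j then 1 else 0 := by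
    intro j
    obtain ⟨g, hg⟩ := LinearMap.exists_extend (b.coord j)
    obtain ⟨y, hy⟩ := hsurj (-g)
    refine ⟨y, fun i => ?_⟩
    have hgi : g (b i) = b.coord j (b i) := LinearMap.congr_fun hg (b i)
    rw [← ω.neg_form, hy, LinearMap.neg_apply, neg_neg, hgi, Module.Basis.coord_apply,
      b.repr_self, Finsupp.single_apply]
  choose y₀ hy₀ using hdual
  have hxx : ∀ i j, ω.form (b i) (b j) = 0 := fun i j =>
    ω.form_eq_zero_of_lagrangian hLag (b i).2 (b j).2
  have hy₀' : ∀ i j, ω.form (y₀ j) (b i) = -if i = j then 1 else 0 := fun i j => by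
    rw [← ω.neg_form, hy₀]
  refine ⟨fun j => y₀ j + ∑ i, (ω.form (y₀ i) (y₀ j) / 2) • (b i : V), fun i j => ?_,
    fun i j => ?_⟩
  · simp [map_sum, hy₀, hxx]
  · simp only [map_add, map_sum, map_smul, LinearMap.add_apply, LinearMap.sum_apply,
      LinearMap.smul_apply, hy₀, hy₀', hxx, smul_eq_mul, mul_zero, mul_ite, mul_one, mul_neg,
      Finset.sum_neg_distrib, Finset.sum_ite_eq', Finset.mem_univ, if_true,
      Finset.sum_const_zero, add_zero]
    rw [← ω.neg_form (y₀ i) (y₀ j)]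
    ring

end AltBilin

section Weyl

variable {M ι : Type*} [AddCommGroup M] [Module k M] [Fintype ι] [DecidableEq ι]

/-- The Euler operator `∑ᵢ Yᵢ Xᵢ`. -/
def eulerOperator (X Y : ι → Module.End k M) : Module.End k M :=
  ∑ i, Y i * X i

theorem eulerOperator_mul {X Y : ι → Module.End k M}
    (hXY : ∀ i j, X i * Y j = Y j * X i + if i = j then 1 else 0)
    (hYY : ∀ i j, Y i * Y j = Y j * Y i) (j : ι) :
    eulerOperator X Y * Y j = Y j * eulerOperator X Y + Y j := by
  simp only [eulerOperator, Finset.sum_mul, Finset.mul_sum, mul_assoc, hXY, mul_add,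
    Finset.sum_add_distrib]
  congr 1
  · exact Finset.sum_congr rfl fun i _ => by rw [← mul_assoc, hYY, mul_assoc]
  · simp

/-- A vacuum vector of a representation of the Weyl algebra generated from a space `Q` of
vacuum vectors under the creation operators `Yᵢ` lies in `Q`. -/
theorem mem_of_annihilated [CharZero k] {X Y : ι → Module.End k M}
    (hXY : ∀ i j, X i * Y j = Y j * X i + if i = j then 1 else 0)
    (hYY : ∀ i j, Y i * Y j = Y j * Y i) {Q : Submodule k M}
    (hQ : ∀ q ∈ Q, ∀ i, X i q = 0)
    (hgen : ∀ P : Submodule k M, Q ≤ P → (∀ i, ∀ q ∈ P, Y i q ∈ P) → P = ⊤)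
    {m : M} (hm : ∀ i, X i m = 0) : m ∈ Q := by
  set E := eulerOperator X Y with hE
  have hker : ∀ q, (∀ i, X i q = 0) → E q = 0 := fun q hq => by
    simp [hE, eulerOperator, hq]
  have hshift : ∀ (μ : k) (i : ι) (q : M), E q = μ • q → E (Y i q) = (μ + 1) • Y i q := by
    intro μ i q hq
    have h := LinearMap.congr_fun (eulerOperator_mul hXY hYY i) q
    simp only [← hE, Module.End.mul_apply, LinearMap.add_apply, hq, map_smul] at h
    rw [h, add_smul, one_smul]
  set R : Submodule k M := ⨆ d : ℕ, E.eigenspace ((d : k) + 1)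
  have htop : Q ⊔ R = ⊤ := by
    refine hgen _ le_sup_left fun i => ?_
    change Q ⊔ R ≤ (Q ⊔ R).comap (Y i)
    refine sup_le (fun q hq => ?_) (iSup_le fun d q hq => ?_)
    · refine Submodule.mem_sup_right (Submodule.mem_iSup_of_mem 0 ?_)
      have h := hshift 0 i q (by rw [hker q (hQ q hq), zero_smul])
      rw [Module.End.mem_eigenspace_iff, h]
      simp
    · refine Submodule.mem_sup_right (Submodule.mem_iSup_of_mem (d + 1) ?_)
      rw [Module.End.mem_eigenspace_iff] at hq ⊢
      rw [hshift _ i q hq]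
      push_cast
      rfl
  obtain ⟨q, hq, r, hr, rfl⟩ := Submodule.mem_sup.1 (htop ▸ Submodule.mem_top : m ∈ Q ⊔ R)
  have hr0 : r ∈ E.eigenspace 0 := by
    have h := hker _ hm
    rw [map_add, hker q (hQ q hq), zero_add] at h
    rw [Module.End.mem_eigenspace_iff, h, zero_smul]
  have hle : R ≤ ⨆ μ, ⨆ _ : μ ≠ (0 : k), E.eigenspace μ :=
    iSup_le fun d => le_iSup₂_of_le ((d : k) + 1) (Nat.cast_add_one_ne_zero d) le_rfl
  have hr' : r = 0 := by
    have h := (E.eigenspaces_iSupIndep 0).le_bot ⟨hr0, hle hr⟩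
    simpa using h
  rwa [hr', add_zero]

end Weyl

namespace Heisenberg

attribute [local instance] LieRing.ofAssociativeRing

variable (ω : AltBilin k V)

section Model

variable {N : Type*} [AddCommGroup N] [Module k N] {ι : Type*}

/-- The linear form `∑ᵢ ω(xᵢ, v) Xᵢ` as a polynomial. -/
noncomputable def linearForm [Fintype ι] (x : ι → V) : V →ₗ[k] MvPolynomial ι k :=
  ∑ i, (ω.form (x i)).smulRight (MvPolynomial.X i)

/-- The derivation `∑ᵢ ω(v, yᵢ) ∂/∂Xᵢ` of the polynomial ring. -/
noncomputable def derivationOf (y : ι → V) :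
    V →ₗ[k] Derivation k (MvPolynomial ι k) (MvPolynomial ι k) :=
  (MvPolynomial.mkDerivationEquiv k).toLinearMap ∘ₗ
    LinearMap.pi fun i => (ω.form.flip (y i)).smulRight (1 : MvPolynomial ι k)

theorem derivationOf_X (y : ι → V) (v : V) (i : ι) :
    derivationOf ω y v (MvPolynomial.X i) = MvPolynomial.C (ω.form v (y i)) := by
  simp [derivationOf, MvPolynomial.mkDerivationEquiv, MvPolynomial.smul_eq_C_mul]

theorem derivationOf_comm (y : ι → V) (v w : V) (p : MvPolynomial ι k) :
    derivationOf ω y v (derivationOf ω y w p) = derivationOf ω y w (derivationOf ω y v p) := by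
  have h : ⁅derivationOf ω y v, derivationOf ω y w⁆ = 0 := by
    refine MvPolynomial.derivation_ext fun i => ?_
    simp [Derivation.commutator_apply, derivationOf_X, ← MvPolynomial.algebraMap_eq]
  have h' := congrArg (fun D => D p) h
  simpa [Derivation.commutator_apply, sub_eq_zero] using h'

variable [Fintype ι]

theorem derivationOf_linearForm (x y : ι → V) (v w : V) :
    derivationOf ω y v (linearForm ω x w) =
      MvPolynomial.C (∑ i, ω.form (x i) w * ω.form v (y i)) := by
  simp [linearForm, derivationOf_X, MvPolynomial.smul_eq_C_mul]

/-- The action of the Heisenberg algebra on `k[Xᵢ] ⊗ N` by multiplications and derivations. -/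
noncomputable def polynomialAction (x y : ι → V) (ζ : Module.End k N) :
    Heisenberg ω →ₗ[k] Module.End k (MvPolynomial ι k ⊗[k] N) where
  toFun h := TensorProduct.map (LinearMap.mulLeft k (linearForm ω x h.1)) LinearMap.id
    + TensorProduct.map (derivationOf ω y h.1 : MvPolynomial ι k →ₗ[k] MvPolynomial ι k) ζ
    + h.2 • TensorProduct.map LinearMap.id ζ
  map_add' g h := by
    refine TensorProduct.ext' fun p n => ?_
    have h1 : (g + h).1 = g.1 + h.1 := rfl
    have h2 : (g + h).2 = g.2 + h.2 := rfl
    simp [h1, h2, add_mul, TensorProduct.add_tmul, add_smul]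
    abel
  map_smul' c h := by
    refine TensorProduct.ext' fun p n => ?_
    have h1 : (c • h).1 = c • h.1 := rfl
    have h2 : (c • h).2 = c * h.2 := rfl
    simp [h1, h2, TensorProduct.smul_tmul', mul_smul]

theorem polynomialAction_tmul (x y : ι → V) (ζ : Module.End k N) (h : Heisenberg ω)
    (p : MvPolynomial ι k) (n : N) :
    polynomialAction ω x y ζ h (p ⊗ₜ n) =
      (linearForm ω x h.1 * p) ⊗ₜ n + derivationOf ω y h.1 p ⊗ₜ ζ n + h.2 • (p ⊗ₜ ζ n) :=
  rfl

/-- In Darboux coordinates the polynomial action is a representation. -/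
noncomputable def polynomialRep {x y : ι → V} (ζ : Module.End k N)
    (hω : ∀ v w, ω.form v w =
      ∑ i, (ω.form (x i) w * ω.form v (y i) - ω.form (x i) v * ω.form w (y i))) :
    Heisenberg ω →ₗ⁅k⁆ Module.End k (MvPolynomial ι k ⊗[k] N) where
  __ := polynomialAction ω x y ζ
  map_lie' {g h} := by
    refine TensorProduct.ext' fun p n => ?_
    change polynomialAction ω x y ζ ⁅g, h⁆ (p ⊗ₜ n) =
      polynomialAction ω x y ζ g (polynomialAction ω x y ζ h (p ⊗ₜ n)) -
        polynomialAction ω x y ζ h (polynomialAction ω x y ζ g (p ⊗ₜ n))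
    have h1 : (⁅g, h⁆ : Heisenberg ω).1 = 0 := rfl
    have h2 : (⁅g, h⁆ : Heisenberg ω).2 = ω.form g.1 h.1 := rfl
    simp only [polynomialAction_tmul, map_add, h1, h2, hω g.1 h.1, Derivation.leibniz,
      derivationOf_linearForm, map_zero, zero_mul, TensorProduct.zero_tmul, zero_add,
      Derivation.coe_zero, Pi.zero_apply, TensorProduct.add_tmul, smul_eq_mul,
      derivationOf_comm ω y g.1 h.1, Finset.sum_sub_distrib, sub_smul,
      mul_comm _ (MvPolynomial.C _), ← MvPolynomial.smul_eq_C_mul, mul_left_comm,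
      TensorProduct.smul_tmul', smul_comm h.2 g.2,
      TensorProduct.sub_tmul, mul_smul_comm, Derivation.map_smul]
    abel

end Model

section Induced

variable (N : Type*) [AddCommGroup N] [Module k N] (l : Submodule k V) (ζ : Module.End k N)

theorem lmul_tmul (h : Heisenberg ω) (u : UniversalEnvelopingAlgebra k (Heisenberg ω)) (n : N) :
    lmul ω N h (u ⊗ₜ n) = (UniversalEnvelopingAlgebra.ι k h * u) ⊗ₜ n :=
  rfl

variable {N l} in
theorem mul_tmul_sub_mem_relN (u : UniversalEnvelopingAlgebra k (Heisenberg ω)) {x : V}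
    (hx : x ∈ l) (c : k) (n : N) :
    (u * UniversalEnvelopingAlgebra.ι k (ofVk ω x c)) ⊗ₜ[k] n - u ⊗ₜ[k] (c • ζ n) ∈
      relN ω N l ζ :=
  Submodule.subset_span ⟨u, x, hx, c, n, rfl⟩

theorem relN_le_comap_lmul (h : Heisenberg ω) :
    relN ω N l ζ ≤ (relN ω N l ζ).comap (lmul ω N h) := by
  refine Submodule.span_le.2 ?_
  rintro _ ⟨u, x, hx, c, n, rfl⟩
  rw [SetLike.mem_coe, Submodule.mem_comap, map_sub, lmul_tmul, lmul_tmul, ← mul_assoc]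
  exact mul_tmul_sub_mem_relN ω ζ _ hx c n

/-- The induced module `G(N)`. -/
abbrev Induced : Type _ :=
  (UniversalEnvelopingAlgebra k (Heisenberg ω) ⊗[k] N) ⧸ relN ω N l ζ

/-- The action of the Heisenberg algebra on `G(N)`. -/
noncomputable def act : Heisenberg ω →ₗ[k] Module.End k (Induced ω N l ζ) where
  toFun h := Submodule.mapQ _ _ (lmul ω N h) (relN_le_comap_lmul ω N l ζ h)
  map_add' g h := by
    refine Submodule.linearMap_qext _ (TensorProduct.ext' fun u n => ?_)
    simp [lmul_tmul, add_mul, TensorProduct.add_tmul]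
  map_smul' c h := by
    refine Submodule.linearMap_qext _ (TensorProduct.ext' fun u n => ?_)
    change (relN ω N l ζ).mkQ ((UniversalEnvelopingAlgebra.ι k (c • h) * u) ⊗ₜ[k] n) =
      c • (relN ω N l ζ).mkQ ((UniversalEnvelopingAlgebra.ι k h * u) ⊗ₜ[k] n)
    rw [map_smul, smul_mul_assoc, ← TensorProduct.smul_tmul', map_smul]

theorem act_mul_act (g h : Heisenberg ω) :
    act ω N l ζ g * act ω N l ζ h = act ω N l ζ h * act ω N l ζ g + act ω N l ζ ⁅g, h⁆ := by
  refine Submodule.linearMap_qext _ (TensorProduct.ext' fun u n => ?_)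
  change Submodule.Quotient.mk ((UniversalEnvelopingAlgebra.ι k g *
      (UniversalEnvelopingAlgebra.ι k h * u)) ⊗ₜ[k] n) =
    Submodule.Quotient.mk ((UniversalEnvelopingAlgebra.ι k h *
      (UniversalEnvelopingAlgebra.ι k g * u)) ⊗ₜ[k] n +
        (UniversalEnvelopingAlgebra.ι k ⁅g, h⁆ * u) ⊗ₜ[k] n)
  rw [← TensorProduct.add_tmul, LieHom.map_lie, LieRing.of_associative_ring_bracket, sub_mul,
    mul_assoc, mul_assoc, add_sub_cancel]

theorem lie_ofV_ofV (v w : V) : ⁅ofV ω v, ofV ω w⁆ = ω.form v w • zH ω := by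
  refine Prod.ext ?_ ?_
  · exact (smul_zero _).symm
  · exact (mul_one _).symm

theorem lie_zH (h : Heisenberg ω) : ⁅zH ω, h⁆ = 0 := by
  refine Prod.ext rfl ?_
  change ω.form 0 h.1 = 0
  simp

theorem act_zH_mul (h : Heisenberg ω) :
    act ω N l ζ (zH ω) * act ω N l ζ h = act ω N l ζ h * act ω N l ζ (zH ω) := by
  rw [act_mul_act, lie_zH, map_zero, add_zero]

/-- The unit map `n ↦ 1 ⊗ n` from `N` to `G(N)`. -/
noncomputable def unitMap : N →ₗ[k] Induced ω N l ζ :=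
  (relN ω N l ζ).mkQ ∘ₗ TensorProduct.mk k _ N 1

theorem act_ofVk_unitMap {x : V} (hx : x ∈ l) (c : k) (n : N) :
    act ω N l ζ (ofVk ω x c) (unitMap ω N l ζ n) = unitMap ω N l ζ (c • ζ n) := by
  refine (Submodule.Quotient.eq _).2 ?_
  have h := mul_tmul_sub_mem_relN ω ζ (1 : UniversalEnvelopingAlgebra k (Heisenberg ω)) hx c n
  rwa [one_mul, ← mul_one (UniversalEnvelopingAlgebra.ι k (ofVk ω x c))] at h

theorem act_ofV_unitMap {x : V} (hx : x ∈ l) (n : N) :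
    act ω N l ζ (ofV ω x) (unitMap ω N l ζ n) = 0 := by
  have h := act_ofVk_unitMap ω N l ζ hx 0 n
  rwa [zero_smul, map_zero] at h

theorem act_zH_unitMap (n : N) :
    act ω N l ζ (zH ω) (unitMap ω N l ζ n) = unitMap ω N l ζ (ζ n) := by
  have h := act_ofVk_unitMap ω N l ζ l.zero_mem 1 n
  rwa [one_smul] at h

theorem adjoin_range_ι : Algebra.adjoin k (Set.range (UniversalEnvelopingAlgebra.ι k)) =
    (⊤ : Subalgebra k (UniversalEnvelopingAlgebra k (Heisenberg ω))) := by
  set S := Algebra.adjoin k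
    (Set.range (UniversalEnvelopingAlgebra.ι k : Heisenberg ω → UniversalEnvelopingAlgebra k _))
  let f : Heisenberg ω →ₗ⁅k⁆ S :=
    { toFun h := ⟨UniversalEnvelopingAlgebra.ι k h, Algebra.subset_adjoin ⟨h, rfl⟩⟩
      map_add' g h := Subtype.ext (map_add _ g h)
      map_smul' c h := Subtype.ext (map_smul _ c h)
      map_lie' {g h} := Subtype.ext (LieHom.map_lie _ g h) }
  have hf : S.val.comp (UniversalEnvelopingAlgebra.lift k f) = AlgHom.id k _ := by
    refine UniversalEnvelopingAlgebra.hom_ext k (LieHom.ext fun h => ?_)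
    change ((UniversalEnvelopingAlgebra.lift k f (UniversalEnvelopingAlgebra.ι k h) : S) :
      UniversalEnvelopingAlgebra k (Heisenberg ω)) = UniversalEnvelopingAlgebra.ι k h
    rw [UniversalEnvelopingAlgebra.lift_ι_apply]
    rfl
  refine eq_top_iff.2 fun u _ => ?_
  have hu := AlgHom.congr_fun hf u
  rw [AlgHom.id_apply] at hu
  rw [← hu]
  exact (UniversalEnvelopingAlgebra.lift k f u).2

/-- `G(N)` is generated by the image of the unit map. -/
theorem eq_top_of_act_mem {P : Submodule k (Induced ω N l ζ)}
    (hP : LinearMap.range (unitMap ω N l ζ) ≤ P)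
    (hact : ∀ h, ∀ q ∈ P, act ω N l ζ h q ∈ P) : P = ⊤ := by
  have key : ∀ u : UniversalEnvelopingAlgebra k (Heisenberg ω),
      P.comap (relN ω N l ζ).mkQ ≤ (P.comap (relN ω N l ζ).mkQ).comap
        (Module.End.rTensorAlgHom k _ N (LinearMap.mulLeft k u)) := by
    intro u
    have hu : u ∈ Algebra.adjoin k (Set.range (UniversalEnvelopingAlgebra.ι k)) := by
      rw [adjoin_range_ι]; trivial
    induction hu using Algebra.adjoin_induction with
    | mem u hu =>
      obtain ⟨h, rfl⟩ := hu
      exact fun t ht => hact h _ ht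
    | algebraMap c =>
      intro t ht
      have : LinearMap.mulLeft k (algebraMap k (UniversalEnvelopingAlgebra k (Heisenberg ω)) c) =
          c • LinearMap.id := by
        ext; simp [Algebra.smul_def]
      rw [Submodule.mem_comap, this, map_smul]
      exact Submodule.smul_mem _ c (by simpa [← Module.End.one_eq_id] using ht)
    | add u v _ _ hu hv =>
      intro t ht
      have : LinearMap.mulLeft k (u + v) = LinearMap.mulLeft k u + LinearMap.mulLeft k v := by
        ext; simp [add_mul]
      rw [Submodule.mem_comap, this, map_add]
      exact Submodule.add_mem _ (hu ht) (hv ht)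
    | mul u v _ _ hu hv =>
      intro t ht
      rw [Submodule.mem_comap, LinearMap.mulLeft_mul, ← Module.End.mul_eq_comp, map_mul]
      exact hu (hv ht)
  refine eq_top_iff.2 fun q _ => ?_
  obtain ⟨t, rfl⟩ := Submodule.Quotient.mk_surjective _ q
  induction t using TensorProduct.induction_on with
  | zero => exact P.zero_mem
  | add s t hs ht => exact P.add_mem (hs trivial) (ht trivial)
  | tmul u n =>
    have h : (1 : UniversalEnvelopingAlgebra k (Heisenberg ω)) ⊗ₜ[k] n ∈
        P.comap (relN ω N l ζ).mkQ := hP ⟨n, rfl⟩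
    have h' := key u h
    rw [Submodule.mem_comap] at h'
    have e : Module.End.rTensorAlgHom k _ N (LinearMap.mulLeft k u) (1 ⊗ₜ[k] n) = u ⊗ₜ[k] n := by
      change (u * 1) ⊗ₜ[k] n = _
      rw [mul_one]
    rwa [e] at h'

variable {l} in
/-- `G(N)` is generated by the image of the unit map under the action of a complement of `l`. -/
theorem eq_top_of_act_complement_mem {ι : Type*} [Fintype ι] {c : ι → V → k} {y : ι → V}
    (hc : ∀ v, v - ∑ i, c i v • y i ∈ l) {P : Submodule k (Induced ω N l ζ)}
    (hP : LinearMap.range (unitMap ω N l ζ) ≤ P)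
    (hy : ∀ i, ∀ q ∈ P, act ω N l ζ (ofV ω (y i)) q ∈ P) : P = ⊤ := by
  set A := act ω N l ζ
  set C : Set (Submodule k (Induced ω N l ζ)) :=
    {R | LinearMap.range (unitMap ω N l ζ) ≤ R ∧ ∀ i, ∀ q ∈ R, A (ofV ω (y i)) q ∈ R}
  set S := sInf C
  have hunit : LinearMap.range (unitMap ω N l ζ) ≤ S := le_sInf fun R hR => hR.1
  have hSy : ∀ i, ∀ q ∈ S, A (ofV ω (y i)) q ∈ S := fun i q hq =>
    Submodule.mem_sInf.2 fun R hR => hR.2 i q (Submodule.mem_sInf.1 hq R hR)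
  have hSz : ∀ q ∈ S, A (zH ω) q ∈ S := by
    suffices h : S.comap (A (zH ω)) ∈ C from sInf_le h
    refine ⟨?_, fun i q hq => ?_⟩
    · rintro _ ⟨n, rfl⟩
      rw [Submodule.mem_comap, act_zH_unitMap]
      exact hunit ⟨_, rfl⟩
    · rw [Submodule.mem_comap, ← Module.End.mul_apply, act_zH_mul]
      exact hSy i _ hq
  have hSx : ∀ x ∈ l, ∀ q ∈ S, A (ofV ω x) q ∈ S := by
    intro x hx
    suffices h : S ⊓ S.comap (A (ofV ω x)) ∈ C from fun q hq => (sInf_le h hq).2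
    refine ⟨?_, fun i q hq => ?_⟩
    · rintro _ ⟨n, rfl⟩
      refine ⟨hunit ⟨n, rfl⟩, ?_⟩
      rw [SetLike.mem_coe, Submodule.mem_comap, act_ofV_unitMap ω N l ζ hx]
      exact S.zero_mem
    · refine ⟨hSy i q hq.1, ?_⟩
      rw [SetLike.mem_coe, Submodule.mem_comap, ← Module.End.mul_apply, act_mul_act, lie_ofV_ofV,
        map_smul]
      exact S.add_mem (hSy i _ hq.2) (S.smul_mem _ (hSz q hq.1))
  refine top_le_iff.1 ((eq_top_of_act_mem ω N l ζ hunit fun h q hq => ?_).ge.trans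
    (sInf_le ⟨hP, hy⟩))
  have hdecomp : h = ofV ω (h.1 - ∑ i, c i h.1 • y i) + ∑ i, c i h.1 • ofV ω (y i)
      + h.2 • zH ω := by
    let j : V →ₗ[k] Heisenberg ω := LinearMap.inl k V k
    have hj : ∀ v, ofV ω v = j v := fun _ => rfl
    simp only [hj, map_sub, map_sum, map_smul, sub_add_cancel]
    refine Prod.ext ?_ ?_
    · change h.1 = h.1 + h.2 • (0 : V)
      simp
    · change h.2 = 0 + h.2 * 1
      simp
  rw [hdecomp]
  simp only [map_add, map_sum, map_smul, LinearMap.add_apply, LinearMap.sum_apply,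
    LinearMap.smul_apply]
  exact S.add_mem (S.add_mem (hSx _ (hc _) q hq)
    (S.sum_mem fun i _ => S.smul_mem _ (hSy i q hq))) (S.smul_mem _ (hSz q hq))

variable {ζ} in
/-- The inverse of the action of `z` on `G(N)`. -/
theorem exists_act_zH_inverse (hζ : Function.Bijective ζ) :
    ∃ J : Module.End k (Induced ω N l ζ), J * act ω N l ζ (zH ω) = 1 ∧
      ∀ h, J * act ω N l ζ h = act ω N l ζ h * J := by
  set e := LinearEquiv.ofBijective ζ hζ
  have he : ∀ n, e.symm (ζ n) = n := e.symm_apply_apply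
  have he' : ∀ n, ζ (e.symm n) = n := e.apply_symm_apply
  set T := LinearMap.lTensor (UniversalEnvelopingAlgebra k (Heisenberg ω)) e.symm.toLinearMap
    with hT
  have hle : relN ω N l ζ ≤ (relN ω N l ζ).comap T := by
    refine Submodule.span_le.2 ?_
    rintro _ ⟨u, x, hx, c, n, rfl⟩
    have h := mul_tmul_sub_mem_relN ω ζ u hx c (e.symm n)
    simpa [hT, he, he'] using h
  set J : Module.End k (Induced ω N l ζ) := Submodule.mapQ _ _ T hle
  have hcomm : ∀ h, J * act ω N l ζ h = act ω N l ζ h * J := fun h =>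
    Submodule.linearMap_qext _ (TensorProduct.ext' fun u n => rfl)
  refine ⟨J, ?_, hcomm⟩
  suffices h : LinearMap.eqLocus (J * act ω N l ζ (zH ω)) 1 = ⊤ from
    LinearMap.ext fun q => (h ▸ Submodule.mem_top :
      q ∈ LinearMap.eqLocus (J * act ω N l ζ (zH ω)) 1)
  refine eq_top_of_act_mem ω N l ζ ?_ fun h q hq => ?_
  · rintro _ ⟨n, rfl⟩
    rw [LinearMap.mem_eqLocus, Module.End.mul_apply, act_zH_unitMap, Module.End.one_apply]
    change unitMap ω N l ζ (e.symm (ζ n)) = _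
    rw [he]
  · rw [LinearMap.mem_eqLocus] at hq ⊢
    rw [← Module.End.mul_apply, mul_assoc, act_zH_mul, ← mul_assoc, hcomm, mul_assoc,
      Module.End.mul_apply, hq]
    rfl

end Induced

section Darboux

variable {l : Submodule k V} {ι : Type*} [Fintype ι] [DecidableEq ι] {b : Module.Basis ι k l}
  {y : ι → V}

theorem sub_sum_mem_of_dual (hLag : ∀ v : V, v ∈ l ↔ ∀ x ∈ l, ω.form v x = 0)
    (hxy : ∀ i j, ω.form (b i) (y j) = if i = j then 1 else 0) (v : V) :
    v - ∑ i, ω.form (b i) v • y i ∈ l := by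
  have h : ω.form (v - ∑ i, ω.form (b i) v • y i) ∘ₗ l.subtype = 0 := by
    refine b.ext fun i => ?_
    rw [LinearMap.comp_apply, Submodule.subtype_apply, ← ω.neg_form]
    simp [hxy]
  exact (hLag _).2 fun x hx => LinearMap.congr_fun h ⟨x, hx⟩

theorem form_eq_sum_of_darboux (hLag : ∀ v : V, v ∈ l ↔ ∀ x ∈ l, ω.form v x = 0)
    (hxy : ∀ i j, ω.form (b i) (y j) = if i = j then 1 else 0)
    (hyy : ∀ i j, ω.form (y i) (y j) = 0) (v w : V) :
    ω.form v w = ∑ i, (ω.form (b i) w * ω.form v (y i) - ω.form (b i) v * ω.form w (y i)) := by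
  obtain ⟨a, ha, hv⟩ : ∃ a ∈ l, v = a + ∑ i, ω.form (b i) v • y i :=
    ⟨_, sub_sum_mem_of_dual ω hLag hxy v, (sub_add_cancel _ _).symm⟩
  obtain ⟨a', ha', hw⟩ : ∃ a ∈ l, w = a + ∑ i, ω.form (b i) w • y i :=
    ⟨_, sub_sum_mem_of_dual ω hLag hxy w, (sub_add_cancel _ _).symm⟩
  have hwy : ∀ i, ω.form w (y i) = -ω.form (y i) a' := fun i => by
    rw [ω.neg_form]
    conv_lhs => rw [hw]
    simp [hyy]
  have hva : ω.form v a' = ∑ i, ω.form (b i) v * ω.form (y i) a' := by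
    conv_lhs => rw [hv]
    simp [ω.form_eq_zero_of_lagrangian hLag ha ha']
  simp only [hwy, mul_neg, sub_neg_eq_add, Finset.sum_add_distrib, ← hva]
  conv_lhs => rw [hw]
  simp [add_comm]

end Darboux

variable {N : Type*} [AddCommGroup N] [Module k N] {l : Submodule k V} {ζ : Module.End k N}

theorem unitMap_injective {ι : Type*} [Fintype ι] {x y : ι → V}
    (hω : ∀ v w, ω.form v w =
      ∑ i, (ω.form (x i) w * ω.form v (y i) - ω.form (x i) v * ω.form w (y i)))
    (hx : ∀ v ∈ l, ∀ i, ω.form (x i) v = 0) :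
    Function.Injective (unitMap ω N l ζ) := by
  set ρ := UniversalEnvelopingAlgebra.lift k (polynomialRep ω ζ hω)
  let φ : UniversalEnvelopingAlgebra k (Heisenberg ω) ⊗[k] N →ₗ[k] MvPolynomial ι k ⊗[k] N :=
    TensorProduct.lift <| LinearMap.mk₂ k (fun u n => ρ u (1 ⊗ₜ n))
      (fun u v n => by simp) (fun c u n => by simp)
      (fun u m n => by simp [TensorProduct.tmul_add]) (fun c u n => by simp)
  have hφ : relN ω N l ζ ≤ LinearMap.ker φ := by
    refine Submodule.span_le.2 ?_
    rintro _ ⟨u, v, hv, c, n, rfl⟩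
    have hl : linearForm ω x v = 0 := by simp [linearForm, hx v hv]
    have h : ρ (UniversalEnvelopingAlgebra.ι k (ofVk ω v c)) (1 ⊗ₜ[k] n) = 1 ⊗ₜ[k] (c • ζ n) := by
      rw [UniversalEnvelopingAlgebra.lift_ι_apply]
      change polynomialAction ω x y ζ (ofVk ω v c) (1 ⊗ₜ[k] n) = _
      rw [polynomialAction_tmul]
      change (linearForm ω x v * 1) ⊗ₜ[k] n + derivationOf ω y v 1 ⊗ₜ[k] ζ n +
        c • (1 ⊗ₜ[k] ζ n) = _
      simp [hl]
    change φ _ = 0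
    simp only [φ, map_sub, TensorProduct.lift.tmul, LinearMap.mk₂_apply, map_mul,
      Module.End.mul_apply, h, sub_self]
  rw [← LinearMap.ker_eq_bot, LinearMap.ker_eq_bot']
  intro n hn
  have h1 : φ (1 ⊗ₜ n) = 0 := hφ ((Submodule.Quotient.mk_eq_zero _).1 hn)
  have h2 : φ (1 ⊗ₜ n) = 1 ⊗ₜ n := by simp [φ]
  have h3 := congrArg (fun t => TensorProduct.lid k N
    (LinearMap.rTensor N (MvPolynomial.aeval (0 : ι → k)).toLinearMap t)) (h2.symm.trans h1)
  simpa using h3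

theorem mem_range_unitMap [CharZero k] (hζ : Function.Bijective ζ) {ι : Type*} [Fintype ι]
    [DecidableEq ι] {b : Module.Basis ι k l} {y : ι → V}
    (hLag : ∀ v : V, v ∈ l ↔ ∀ x ∈ l, ω.form v x = 0)
    (hxy : ∀ i j, ω.form (b i) (y j) = if i = j then 1 else 0)
    (hyy : ∀ i j, ω.form (y i) (y j) = 0) {q : Induced ω N l ζ}
    (hq : ∀ x ∈ l, act ω N l ζ (ofV ω x) q = 0) : q ∈ LinearMap.range (unitMap ω N l ζ) := by
  obtain ⟨J, hJz, hJ⟩ := exists_act_zH_inverse ω N l hζ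
  refine mem_of_annihilated (X := fun i => J * act ω N l ζ (ofV ω (b i)))
    (Y := fun i => act ω N l ζ (ofV ω (y i))) (fun i j => ?_) (fun i j => ?_) ?_
    (fun P hP hy => eq_top_of_act_complement_mem ω N ζ
      (c := fun i => ω.form (b i)) (sub_sum_mem_of_dual ω hLag hxy) hP hy) fun i => ?_
  · rw [mul_assoc, act_mul_act, lie_ofV_ofV, map_smul, hxy, mul_add, ← mul_assoc, hJ, mul_assoc,
      mul_smul_comm, hJz, ite_smul, one_smul, zero_smul]
  · rw [act_mul_act, lie_ofV_ofV, hyy, zero_smul, map_zero, add_zero]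
  · rintro _ ⟨n, rfl⟩ i
    rw [Module.End.mul_apply, act_ofV_unitMap ω N l ζ (b i).2, map_zero]
  · rw [Module.End.mul_apply, hq _ (b i).2, map_zero]

end Heisenberg

/-- for every `𝔷`-module `N` on which `z` acts invertibly (with
action `ζ`), the unit map `N → G(N)^𝔩 = (U(𝔥) ⊗_{U(𝔭)} E(N))^𝔩`, `n ↦ 1 ⊗ n`,
is an isomorphism of `𝔷`-modules. Here `G(N)` is presented as the quotient of
`U(𝔥) ⊗_k N` by the relation submodule `relN`, and the claims are: `1 ⊗ n` is
`𝔩`-invariant modulo relations; the unit intertwines `ζ` with the action of `z`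
modulo relations; the unit is injective modulo relations; and every
`𝔩`-invariant-modulo-relations element is congruent to some `1 ⊗ n`. -/
theorem stmt6 {k V : Type*} [Field k] [CharZero k] [AddCommGroup V] [Module k V]
    [FiniteDimensional k V] (ω : AltBilin k V)
    (hnondeg : ∀ v : V, (∀ w : V, ω.form v w = 0) → v = 0)
    (l : Submodule k V) (hLag : ∀ v : V, v ∈ l ↔ ∀ x ∈ l, ω.form v x = 0)
    (N : Type*) [AddCommGroup N] [Module k N]
    (ζ : Module.End k N) (hζ : Function.Bijective ζ) :
    (∀ (n : N) (x : V), x ∈ l →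
        lmul ω N (Heisenberg.ofV ω x) ((1 : UniversalEnvelopingAlgebra k (Heisenberg ω)) ⊗ₜ[k] n)
          ∈ relN ω N l ζ)
    ∧ (∀ n : N,
        lmul ω N (Heisenberg.zH ω) ((1 : UniversalEnvelopingAlgebra k (Heisenberg ω)) ⊗ₜ[k] n)
            - (1 : UniversalEnvelopingAlgebra k (Heisenberg ω)) ⊗ₜ[k] (ζ n)
          ∈ relN ω N l ζ)
    ∧ (∀ n : N,
        (1 : UniversalEnvelopingAlgebra k (Heisenberg ω)) ⊗ₜ[k] n ∈ relN ω N l ζ → n = 0)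
    ∧ (∀ t : UniversalEnvelopingAlgebra k (Heisenberg ω) ⊗[k] N,
        (∀ x ∈ l, lmul ω N (Heisenberg.ofV ω x) t ∈ relN ω N l ζ) →
        ∃ n : N, t - (1 : UniversalEnvelopingAlgebra k (Heisenberg ω)) ⊗ₜ[k] n
          ∈ relN ω N l ζ) := by
  classical
  obtain ⟨y, hxy, hyy⟩ := ω.exists_isotropic_dual hnondeg hLag (Module.finBasis k l)
  refine ⟨fun n x hx => ?_, fun n => ?_, fun n hn => ?_, fun t ht => ?_⟩
  · exact (Submodule.Quotient.mk_eq_zero _).1 (Heisenberg.act_ofV_unitMap ω N l ζ hx n)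
  · exact (Submodule.Quotient.eq _).1 (Heisenberg.act_zH_unitMap ω N l ζ n)
  · refine Heisenberg.unitMap_injective ω (l := l) (ζ := ζ)
      (Heisenberg.form_eq_sum_of_darboux ω hLag hxy hyy)
      (fun v hv i => ω.form_eq_zero_of_lagrangian hLag (Module.finBasis k l i).2 hv) ?_
    rw [map_zero]
    exact (Submodule.Quotient.mk_eq_zero _).2 hn
  · obtain ⟨n, hn⟩ := Heisenberg.mem_range_unitMap ω hζ hLag hxy hyy
      (q := Submodule.Quotient.mk t) fun x hx => (Submodule.Quotient.mk_eq_zero _).2 (ht x hx)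
    exact ⟨n, (Submodule.Quotient.eq _).1 hn.symm⟩
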